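/- For every positive integer τ that divides T, the worst-case dynamic regret satisfies DReg* ≤ (T/τ)·SAReg(T, τ) + 2·τ·V(1,T). -/

import Mathlib

/-- Local functional variation of `f` over the interval `[s, q]`:
`V(s,q) = ∑_{t=s+1}^{q} max_{w ∈ Ω} |f_t(w) − f_{t−1}(w)|`. -/
noncomputable def locVar {E : Type*} [NormedAddCommGroup E] [NormedSpace ℝ E]
    (Ω : Set E) (f : ℕ → E → ℝ) (s q : ℕ) : ℝ :=
  ∑ t ∈ Finset.Icc (s + 1) q, sSup ((fun x => |f t x - f (t - 1) x|) '' Ω)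

/-- Static regret of the decisions `w` over the interval `[s, q]`. -/
noncomputable def statReg {E : Type*} [NormedAddCommGroup E] [NormedSpace ℝ E]
    (Ω : Set E) (f : ℕ → E → ℝ) (w : ℕ → E) (s q : ℕ) : ℝ :=
  (∑ t ∈ Finset.Icc s q, f t (w t)) - sInf ((fun x => ∑ t ∈ Finset.Icc s q, f t x) '' Ω)

/-- Strongly adaptive regret at scale `τ`: the maximum of the static regret over all
intervals `[s, s+τ−1] ⊆ [1, T]`. -/
noncomputable def SAReg {E : Type*} [NormedAddCommGroup E] [NormedSpace ℝ E]
    (Ω : Set E) (f : ℕ → E → ℝ) (w : ℕ → E) (T τ : ℕ) : ℝ :=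
  sSup ((fun s => statReg Ω f w s (s + τ - 1)) '' Set.Icc 1 (T - τ + 1))

/-- Worst-case dynamic regret over `T` rounds. -/
noncomputable def DRegStar {E : Type*} [NormedAddCommGroup E] [NormedSpace ℝ E]
    (Ω : Set E) (f : ℕ → E → ℝ) (w : ℕ → E) (T : ℕ) : ℝ :=
  (∑ t ∈ Finset.Icc 1 T, f t (w t)) - ∑ t ∈ Finset.Icc 1 T, sInf ((f t) '' Ω)

theorem dterm_nonneg {E : Type*} (Ω : Set E) (g h : E → ℝ) :
    0 ≤ sSup ((fun x => |g x - h x|) '' Ω) := by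
  apply Real.sSup_nonneg
  rintro _ ⟨x, _, rfl⟩
  exact abs_nonneg _

theorem locVar_mono {E : Type*} [NormedAddCommGroup E] [NormedSpace ℝ E]
    (Ω : Set E) (f : ℕ → E → ℝ) (s q r : ℕ) (h : q ≤ r) : locVar Ω f s q ≤ locVar Ω f s r := by
  unfold locVar
  apply Finset.sum_le_sum_of_subset_of_nonneg
  · exact Finset.Icc_subset_Icc le_rfl h
  · intro i _ _
    exact dterm_nonneg Ω _ _

theorem abs_sub_le_locVar {E : Type*} [NormedAddCommGroup E] [NormedSpace ℝ E]
    (T : ℕ) (Ω : Set E) (hΩ : IsCompact Ω)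
    (f : ℕ → E → ℝ) (hf : ∀ t ∈ Finset.Icc 1 T, ContinuousOn (f t) Ω)
    (s t : ℕ) (hs : 1 ≤ s) (hst : s ≤ t) (htT : t ≤ T) (x : E) (hx : x ∈ Ω) :
    |f t x - f s x| ≤ locVar Ω f s t := by
  induction t, hst using Nat.le_induction with
  | base => simp [locVar]
  | succ t hst ih =>
    have ih := ih (by omega)
    have h1 : locVar Ω f s (t + 1) = locVar Ω f s t
        + sSup ((fun x => |f (t + 1) x - f t x|) '' Ω) := by
      unfold locVar
      rw [Finset.sum_Icc_succ_top (by omega)]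
      simp
    have h2 : |f (t + 1) x - f t x| ≤ sSup ((fun x => |f (t + 1) x - f t x|) '' Ω) := by
      apply le_csSup
      · apply (hΩ.image_of_continuousOn _).bddAbove
        exact ((hf (t + 1) (by simp; omega)).sub (hf t (by simp; omega))).abs
      · exact ⟨x, hx, rfl⟩
    have h3 := abs_sub_le (f (t + 1) x) (f t x) (f s x)
    linarith

theorem block_bound {E : Type*} [NormedAddCommGroup E] [NormedSpace ℝ E]
    (T : ℕ) (Ω : Set E) (hΩne : Ω.Nonempty) (hΩ : IsCompact Ω)
    (f : ℕ → E → ℝ) (hf : ∀ t ∈ Finset.Icc 1 T, ContinuousOn (f t) Ω)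
    (w : ℕ → E) (s τ : ℕ) (hs : 1 ≤ s) (hτ : 1 ≤ τ) (hqT : s + τ - 1 ≤ T) :
    (∑ t ∈ Finset.Icc s (s + τ - 1), f t (w t))
        - ∑ t ∈ Finset.Icc s (s + τ - 1), sInf ((f t) '' Ω) ≤
      statReg Ω f w s (s + τ - 1) + 2 * (τ : ℝ) * locVar Ω f s (s + τ - 1) := by
  obtain ⟨x, hx, hmin⟩ := hΩ.exists_isMinOn hΩne (hf s (by simp; omega))
  have h1 : sInf ((fun x => ∑ t ∈ Finset.Icc s (s + τ - 1), f t x) '' Ω) ≤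
      ∑ t ∈ Finset.Icc s (s + τ - 1), f t x := by
    apply csInf_le
    · apply (hΩ.image_of_continuousOn _).bddBelow
      apply continuousOn_finsetSum
      intro t ht
      rw [Finset.mem_Icc] at ht
      exact hf t (by simp; omega)
    · exact ⟨x, hx, rfl⟩
  have h2 : ∑ t ∈ Finset.Icc s (s + τ - 1), f t x ≤
      ∑ t ∈ Finset.Icc s (s + τ - 1), (sInf ((f t) '' Ω) + 2 * locVar Ω f s (s + τ - 1)) := by
    apply Finset.sum_le_sum
    intro t ht
    rw [Finset.mem_Icc] at ht
    have hm := locVar_mono Ω f s t (s + τ - 1) ht.2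
    have h3 : f t x - 2 * locVar Ω f s (s + τ - 1) ≤ sInf ((f t) '' Ω) := by
      apply le_csInf (hΩne.image _)
      rintro _ ⟨y, hy, rfl⟩
      have a1 := abs_le.1 (abs_sub_le_locVar T Ω hΩ f hf s t hs ht.1 (by omega) x hx)
      have a2 := abs_le.1 (abs_sub_le_locVar T Ω hΩ f hf s t hs ht.1 (by omega) y hy)
      have a3 : f s x ≤ f s y := hmin hy
      linarith [a1.2, a2.1]
    linarith
  rw [Finset.sum_add_distrib, Finset.sum_const, Nat.card_Icc, nsmul_eq_mul,
    show s + τ - 1 + 1 - s = τ by omega] at h2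
  unfold statReg
  linarith

theorem partial_bound {E : Type*} [NormedAddCommGroup E] [NormedSpace ℝ E]
    (T : ℕ) (Ω : Set E) (hΩne : Ω.Nonempty) (hΩ : IsCompact Ω)
    (f : ℕ → E → ℝ) (hf : ∀ t ∈ Finset.Icc 1 T, ContinuousOn (f t) Ω)
    (w : ℕ → E) (τ : ℕ) (hτ : 1 ≤ τ) (k : ℕ) (hk : k * τ ≤ T) :
    DRegStar Ω f w (k * τ) ≤
      (k : ℝ) * SAReg Ω f w T τ + 2 * (τ : ℝ) * locVar Ω f 1 (k * τ) := by
  induction k with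
  | zero => simp [DRegStar, locVar]
  | succ k ih =>
    have hk' : k * τ + τ ≤ T := by rw [← Nat.succ_mul]; exact hk
    have ih := ih (by omega)
    have hb := block_bound T Ω hΩne hΩ f hf w (k * τ + 1) τ (by omega) hτ (by omega)
    have hS : statReg Ω f w (k * τ + 1) (k * τ + 1 + τ - 1) ≤ SAReg Ω f w T τ := by
      apply le_csSup
      · exact ((Set.finite_Icc _ _).image _).bddAbove
      · exact ⟨k * τ + 1, ⟨by omega, by omega⟩, rfl⟩
    have e : k * τ + 1 + τ - 1 = (k + 1) * τ := by rw [Nat.succ_mul]; omega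
    rw [e] at hb hS
    have hle : k * τ ≤ (k + 1) * τ := by rw [← e]; omega
    have split : ∀ g : ℕ → ℝ, ∑ t ∈ Finset.Icc 1 ((k + 1) * τ), g t =
        ∑ t ∈ Finset.Icc 1 (k * τ), g t + ∑ t ∈ Finset.Icc (k * τ + 1) ((k + 1) * τ), g t := by
      intro g
      rw [← Finset.sum_union]
      · congr 1
        ext t
        simp only [Finset.mem_union, Finset.mem_Icc]
        omega
      · rw [Finset.disjoint_left]
        intro t h1 h2
        rw [Finset.mem_Icc] at h1 h2
        omega
    have hV : locVar Ω f 1 (k * τ) + locVar Ω f (k * τ + 1) ((k + 1) * τ) ≤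
        locVar Ω f 1 ((k + 1) * τ) := by
      unfold locVar
      rw [← Finset.sum_union]
      · apply Finset.sum_le_sum_of_subset_of_nonneg
        · intro t
          simp only [Finset.mem_union, Finset.mem_Icc]
          omega
        · intro i _ _
          exact dterm_nonneg Ω _ _
      · rw [Finset.disjoint_left]
        intro t h1 h2
        rw [Finset.mem_Icc] at h1 h2
        omega
    have hV2 := mul_le_mul_of_nonneg_left hV (by positivity : (0 : ℝ) ≤ 2 * (τ : ℝ))
    unfold DRegStar at ih ⊢
    rw [split, split]
    push_cast
    linarith

/-- For every positive integer `τ` dividing `T`,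
`DReg* ≤ (T/τ) · SAReg(T, τ) + 2 τ V(1,T)`. -/
theorem dynamic_regret_le_equal_length_partition
    {E : Type*} [NormedAddCommGroup E] [NormedSpace ℝ E]
    (T : ℕ) (hT : 1 ≤ T) (Ω : Set E) (hΩne : Ω.Nonempty) (hΩ : IsCompact Ω)
    (f : ℕ → E → ℝ) (hf : ∀ t ∈ Finset.Icc 1 T, ContinuousOn (f t) Ω)
    (w : ℕ → E) (hw : ∀ t ∈ Finset.Icc 1 T, w t ∈ Ω)
    (τ : ℕ) (hτ : 1 ≤ τ) (hdvd : τ ∣ T) :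
    DRegStar Ω f w T ≤
      ((T : ℝ) / (τ : ℝ)) * SAReg Ω f w T τ + 2 * (τ : ℝ) * locVar Ω f 1 T := by
  obtain ⟨k, rfl⟩ := hdvd
  rw [Nat.mul_comm τ k] at *
  have h := partial_bound (k * τ) Ω hΩne hΩ f hf w τ hτ k le_rfl
  have hτ0 : (τ : ℝ) ≠ 0 := by
    have : τ ≠ 0 := by omega
    exact_mod_cast this
  have e : (((k * τ : ℕ) : ℝ) / (τ : ℝ)) = k := by
    push_cast
    field_simp
  rw [e]
  exact h
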